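/- Let G be a group and let f : G → ℂ be a bounded almost automorphic function on the discrete group G (for every ultrafilter 𝒰 on G and all φ, ψ : G → ℂ, if t ↦ f(x·t) converges to φ(x) along 𝒰 for every x and t ↦ φ(x·t⁻¹) converges to ψ(x) along 𝒰 for every x, then ψ = f). Then for every ε > 0 and every finite set N ⊆ G there exist δ > 0 and a finite set M ⊆ G with N ⊆ M such that σ⁻¹·τ ∈ C(f;N,ε) for all σ, τ ∈ C(f;M,δ). -/

import Mathlib

/-- A bounded function `f` on an abstract group `G` is almost automorphic (on the
discrete group) if for every ultrafilter `𝒰` on `G`: whenever `t ↦ f (x * t)` converges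
to `φ x` along `𝒰` for all `x` and `t ↦ φ (x * t⁻¹)` converges to `ψ x` along `𝒰` for
all `x`, then `ψ = f`. -/
def LeftAA {G : Type*} [Group G] (f : G → ℂ) : Prop :=
  ∀ (𝒰 : Ultrafilter G) (φ ψ : G → ℂ),
    (∀ x : G, Filter.Tendsto (fun t => f (x * t)) (𝒰 : Filter G) (nhds (φ x))) →
    (∀ x : G, Filter.Tendsto (fun t => φ (x * t⁻¹)) (𝒰 : Filter G) (nhds (ψ x))) →
    ψ = f

/-- `C(f;N,ε) = {τ : |f(sτt) − f(st)| < ε for all s, t ∈ N}`. -/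
def Cset {G : Type*} [Group G] (f : G → ℂ) (N : Finset G) (ε : ℝ) : Set G :=
  {τ : G | ∀ s ∈ N, ∀ t ∈ N, ‖f (s * τ * t) - f (s * t)‖ < ε}

theorem bdd_lim_exists {ι : Type*} (𝒰 : Ultrafilter ι) (g : ι → ℂ) (C : ℝ)
    (h : ∀ i, ‖g i‖ ≤ C) :
    ∃ z : ℂ, Filter.Tendsto g (𝒰 : Filter ι) (nhds z) := by
  have hc : IsCompact (Metric.closedBall (0 : ℂ) C) := isCompact_closedBall 0 C
  obtain ⟨z, -, hz⟩ := hc.ultrafilter_le_nhds (𝒰.map g) (by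
    rw [Filter.le_principal_iff]
    change Set.preimage g _ ∈ (𝒰 : Filter ι)
    exact Filter.univ_mem' (fun i => by simpa using h i))
  exact ⟨z, hz⟩

/-- Lemma 6.1.10 (Veech's key technical lemma): for all `ε > 0` and finite `N ⊆ G` there
are `δ > 0` and a finite superset `M ⊇ N` with `C(f;M,δ)⁻¹·C(f;M,δ) ⊆ C(f;N,ε)`. -/
theorem stmt15 {G : Type*} [Group G] (f : G → ℂ)
    (hb : ∃ C : ℝ, ∀ x : G, ‖f x‖ ≤ C) (hf : LeftAA f) :
    ∀ (ε : ℝ), 0 < ε → ∀ N : Finset G,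
      ∃ (δ : ℝ) (M : Finset G), 0 < δ ∧ N ⊆ M ∧
        ∀ σ ∈ Cset f M δ, ∀ τ ∈ Cset f M δ, σ⁻¹ * τ ∈ Cset f N ε := by
  classical
  intro ε hε N
  by_contra hcon
  have key : ∀ (M : Finset G) (k : ℕ), ∃ σ τ s t : G,
      σ ∈ Cset f (M ∪ N) (ε / 2 ^ (k + 2)) ∧ τ ∈ Cset f (M ∪ N) (ε / 2 ^ (k + 2)) ∧
      s ∈ N ∧ t ∈ N ∧ ε ≤ ‖f (s * (σ⁻¹ * τ) * t) - f (s * t)‖ := by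
    intro M k
    by_contra h
    refine hcon ⟨ε / 2 ^ (k + 2), M ∪ N, by positivity, Finset.subset_union_right, ?_⟩
    intro σ hσ τ hτ s hs t ht
    by_contra h'
    exact h ⟨σ, τ, s, t, hσ, hτ, hs, ht, not_lt.mp h'⟩
  choose S T A B hS hT hA hB hAB using key
  let M : ℕ → Finset G := fun n => Nat.rec N (fun k M =>
    (M ∪ N).image (fun q => q * T M k) ∪ N.image (fun s => s * ((S M k)⁻¹ * T M k))) n
  have hM : ∀ k, M (k + 1) = (M k ∪ N).image (fun q => q * T (M k) k) ∪
      N.image (fun s => s * ((S (M k) k)⁻¹ * T (M k) k)) := fun k => rfl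
  let P : ℕ → G := fun n => Nat.rec 1 (fun k p => p * T (M k) k) n
  have hP : ∀ k, P (k + 1) = P k * T (M k) k := fun k => rfl
  let u : ℕ → G := fun n => P n * S (M n) n
  -- main estimate
  have main : ∀ n, ∀ s ∈ N, ∀ t ∈ N, ∀ m, n + 1 ≤ m →
      s * (u n)⁻¹ * P m ∈ M m ∧
      ‖f (s * (u n)⁻¹ * P m * t) - f (s * ((S (M n) n)⁻¹ * T (M n) n) * t)‖
        ≤ ε / 2 - ε / 2 ^ (m + 1) := by
    intro n s hs t ht m hm
    induction m, hm using Nat.le_induction with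
    | base =>
      have e : s * (u n)⁻¹ * P (n + 1) = s * ((S (M n) n)⁻¹ * T (M n) n) := by
        rw [hP]; simp only [u]; group
      rw [e]
      refine ⟨?_, ?_⟩
      · rw [hM]
        exact Finset.mem_union_right _ (Finset.mem_image_of_mem _ hs)
      · rw [sub_self, norm_zero, sub_nonneg]
        apply div_le_div_of_nonneg_left hε.le (by norm_num)
        calc (2 : ℝ) = 2 ^ 1 := by norm_num
          _ ≤ 2 ^ (n + 1 + 1) := pow_le_pow_right₀ (by norm_num) (by omega)
    | succ m hm ih =>
      obtain ⟨h1, h2⟩ := ih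
      have e : s * (u n)⁻¹ * P (m + 1) = s * (u n)⁻¹ * P m * T (M m) m := by
        rw [hP]; group
      rw [e]
      refine ⟨?_, ?_⟩
      · rw [hM]
        exact Finset.mem_union_left _ (Finset.mem_image_of_mem (fun q => q * T (M m) m)
          (Finset.mem_union_left _ h1))
      · have h3 := hT (M m) m _ (Finset.mem_union_left _ h1) t (Finset.mem_union_right _ ht)
        have h4 := norm_sub_le_norm_sub_add_norm_sub (f (s * (u n)⁻¹ * P m * T (M m) m * t))
          (f (s * (u n)⁻¹ * P m * t)) (f (s * ((S (M n) n)⁻¹ * T (M n) n) * t))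
        have h5 : ε / 2 ^ (m + 1) = 2 * (ε / 2 ^ (m + 2)) := by
          rw [pow_succ _ (m + 1)]; field_simp
        have h6 : m + 1 + 1 = m + 2 := rfl
        rw [h6]
        linarith
  have main2 : ∀ n m, n < m →
      ε / 2 ≤ ‖f (A (M n) n * (u n)⁻¹ * u m * B (M n) n) - f (A (M n) n * B (M n) n)‖ := by
    intro n m hnm
    obtain ⟨h1, h2⟩ := main n _ (hA (M n) n) _ (hB (M n) n) m hnm
    have h3 := hS (M m) m _ (Finset.mem_union_left _ h1) _
      (Finset.mem_union_right _ (hB (M n) n))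
    have e : A (M n) n * (u n)⁻¹ * P m * S (M m) m = A (M n) n * (u n)⁻¹ * u m := by
      simp only [u]; group
    rw [e] at h3
    have h4 := hAB (M n) n
    have h5 : ε / 2 ^ (m + 1) = 2 * (ε / 2 ^ (m + 2)) := by
      rw [pow_succ _ (m + 1)]; field_simp
    have h6 : 0 < ε / 2 ^ (m + 2) := by positivity
    set a := f (A (M n) n * (u n)⁻¹ * u m * B (M n) n)
    set b := f (A (M n) n * (u n)⁻¹ * P m * B (M n) n)
    set c := f (A (M n) n * ((S (M n) n)⁻¹ * T (M n) n) * B (M n) n)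
    set d := f (A (M n) n * B (M n) n)
    have h7 := norm_sub_le_norm_sub_add_norm_sub c b d
    have h8 := norm_sub_le_norm_sub_add_norm_sub b a d
    rw [norm_sub_rev] at h2 h3
    linarith
  -- pigeonhole along an ultrafilter
  let V : Ultrafilter ℕ := Filter.hyperfilter ℕ
  have hV : (V : Filter ℕ) ≤ Filter.atTop := Nat.hyperfilter_le_atTop
  have hpig : ∃ p ∈ (N ×ˢ N : Finset (G × G)),
      ∀ᶠ n in (V : Filter ℕ), (A (M n) n, B (M n) n) = p := by
    have h0 : ∀ᶠ n in (V : Filter ℕ), ∃ p ∈ ((N ×ˢ N : Finset (G × G)) : Set (G × G)),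
        (A (M n) n, B (M n) n) = p :=
      Filter.Eventually.of_forall (fun n => ⟨_, by
        simpa using ⟨hA (M n) n, hB (M n) n⟩, rfl⟩)
    exact (Ultrafilter.eventually_exists_mem_iff (Finset.finite_toSet _)).mp h0
  obtain ⟨⟨s, t⟩, -, hst⟩ := hpig
  obtain ⟨C, hC⟩ := hb
  let U : Ultrafilter G := V.map (fun n => u n * t)
  choose φ hφ using fun x : G => bdd_lim_exists U (fun y => f (x * y)) C (fun y => hC _)
  have hφC : ∀ x, ‖φ x‖ ≤ C := fun x =>
    le_of_tendsto (hφ x).norm (Filter.Eventually.of_forall fun y => hC _)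
  choose ψ hψ using fun x : G => bdd_lim_exists U (fun y => φ (x * y⁻¹)) C (fun y => hφC _)
  have hEq := hf U φ ψ hφ hψ
  have hφ' : ∀ x, Filter.Tendsto (fun n => f (x * (u n * t))) (V : Filter ℕ) (nhds (φ x)) :=
    fun x => Filter.tendsto_map'_iff.mp (hφ x)
  have hψ' : Filter.Tendsto (fun n => φ (s * t * (u n * t)⁻¹)) (V : Filter ℕ)
      (nhds (ψ (s * t))) := Filter.tendsto_map'_iff.mp (hψ (s * t))
  have hlow : ∀ᶠ n in (V : Filter ℕ), ε / 2 ≤ ‖φ (s * t * (u n * t)⁻¹) - f (s * t)‖ := by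
    filter_upwards [hst] with n hn
    have hn1 : A (M n) n = s := congrArg Prod.fst hn
    have hn2 : B (M n) n = t := congrArg Prod.snd hn
    refine ge_of_tendsto ((hφ' (s * t * (u n * t)⁻¹)).sub_const (f (s * t))).norm ?_
    filter_upwards [hV (Filter.eventually_gt_atTop n)] with m hm
    have h := main2 n m hm
    rw [hn1, hn2] at h
    have e : s * t * (u n * t)⁻¹ * (u m * t) = s * (u n)⁻¹ * u m * t := by group
    rw [e]
    exact h
  have hfin := ge_of_tendsto (hψ'.sub_const (f (s * t))).norm hlow
  rw [hEq, sub_self, norm_zero] at hfin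
  linarith
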